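/- Assume the costs are nonnegative, i.e. c(u,v) ≥ 0 and q(u,v,w) ≥ 0 for all u,v,w ∈ V. Let w = (w₁,…,wₙ) be a walk from s to t and let m be an index with 2 ≤ m ≤ n. Then the set of paths from w_m to t is nonempty, and C((w₁,…,w_m)) + B(w_m) ≤ C(w), where B(w_m) = min { L(p) : p a path from w_m to t }. (This is the admissibility property justifying the A* search with backward linear cost-to-go estimates.) -/

import Mathlib

/-- Linear cost of a walk: sum of `c` over consecutive pairs of vertices. -/
def linCost {V : Type*} (c : V → V → ℝ) : List V → ℝ
  | u :: v :: rest => c u v + linCost c (v :: rest)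
  | _ => 0

/-- Quadratic interaction cost of a walk: sum of `q` over consecutive triples. -/
def quadCost {V : Type*} (q : V → V → V → ℝ) : List V → ℝ
  | u :: v :: x :: rest => q u v x + quadCost q (v :: x :: rest)
  | _ => 0

/-- Total (quadratic) cost `C` of a walk. -/
def cost {V : Type*} (c : V → V → ℝ) (q : V → V → V → ℝ) (w : List V) : ℝ :=
  linCost c w + quadCost q w

/-- A walk from `s` to `t`: a nonempty vertex sequence starting at `s`, ending at `t`,
whose consecutive pairs are arcs. -/
def IsWalk {V : Type*} (A : V → V → Prop) (s t : V) (w : List V) : Prop :=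
  w ≠ [] ∧ w.head? = some s ∧ w.getLast? = some t ∧ w.Chain' A

/-- A path: a walk with pairwise distinct vertices. -/
def IsPath {V : Type*} (A : V → V → Prop) (s t : V) (w : List V) : Prop :=
  IsWalk A s t w ∧ w.Nodup

/-- An α-cycle: a walk `(u₁, …, uₙ)` with `n ≥ 5` and `u₂ = u_{n-1}`. -/
def IsAlphaCycle {V : Type*} (A : V → V → Prop) (w : List V) : Prop :=
  5 ≤ w.length ∧ w.Chain' A ∧ w[1]? = w[w.length - 2]?

/-- An improving α-cycle: an α-cycle `(u₁, …, uₙ)` with `C((u₁,…,uₙ)) < C((u₁,u₂,uₙ))`. -/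
def IsImprovingAlphaCycle {V : Type*} (A : V → V → Prop) (c : V → V → ℝ)
    (q : V → V → V → ℝ) (w : List V) : Prop :=
  IsAlphaCycle A w ∧ ∃ u1 u2 un, w[0]? = some u1 ∧ w[1]? = some u2 ∧
    w.getLast? = some un ∧ cost c q w < cost c q [u1, u2, un]

theorem linCost_nonneg {V : Type*} {c : V → V → ℝ} (hc : ∀ u v, 0 ≤ c u v) (l : List V) :
    0 ≤ linCost c l := by
  fun_induction linCost c l with
  | case1 u v _ ih => exact add_nonneg (hc u v) ih
  | case2 => exact le_rfl

theorem quadCost_nonneg {V : Type*} {q : V → V → V → ℝ} (hq : ∀ u v x, 0 ≤ q u v x)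
    (l : List V) : 0 ≤ quadCost q l := by
  fun_induction quadCost q l with
  | case1 u v x _ ih => exact add_nonneg (hq u v x) ih
  | case2 => exact le_rfl

/-- Linear cost is additive when a walk is split at a vertex. -/
theorem linCost_append_cons {V : Type*} (c : V → V → ℝ) (l : List V) (v : V) (l' : List V) :
    linCost c (l ++ v :: l') = linCost c (l ++ [v]) + linCost c (v :: l') := by
  induction l with
  | nil => simp [linCost]
  | cons a l ih =>
    cases l with
    | nil => simp [linCost]
    | cons b l =>
      simp only [List.cons_append, linCost] at ih ⊢
      rw [ih, add_assoc]

theorem quadCost_le_append {V : Type*} {q : V → V → V → ℝ} (hq : ∀ u v x, 0 ≤ q u v x)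
    (l l' : List V) : quadCost q l ≤ quadCost q (l ++ l') := by
  fun_induction quadCost q l with
  | case1 u v x l ih =>
    simp only [List.cons_append, quadCost] at ih ⊢
    gcongr
  | case2 => exact quadCost_nonneg hq _

/-- Shortcutting: with nonnegative costs, every walk can be reduced to a path with the same
endpoints and no larger linear cost. -/
theorem exists_isPath_linCost_le {V : Type*} {A : V → V → Prop} {c : V → V → ℝ}
    (hc : ∀ u v, 0 ≤ c u v) {t : V} (l : List V) (u : V) (hl : (u :: l).IsChain A)
    (ht : (u :: l).getLast? = some t) :
    ∃ l', IsPath A u t (u :: l') ∧ linCost c (u :: l') ≤ linCost c (u :: l) := by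
  induction l generalizing u with
  | nil => exact ⟨[], ⟨⟨by simp, rfl, ht, hl⟩, by simp⟩, le_rfl⟩
  | cons b l ih =>
    obtain ⟨hub, hbl⟩ := List.isChain_cons_cons.1 hl
    obtain ⟨p, ⟨⟨-, -, hpt, hpA⟩, hpn⟩, hle⟩ := ih b hbl (by simpa using ht)
    by_cases hu : u ∈ b :: p
    · obtain ⟨x, y, hxy⟩ := List.append_of_mem hu
      rw [hxy] at hpt hpA hpn hle
      refine ⟨y, ⟨⟨by simp, rfl, by simpa using hpt, hpA.right_of_append⟩,
        hpn.of_append_right⟩, ?_⟩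
      rw [linCost_append_cons] at hle
      rw [linCost]
      linarith [linCost_nonneg hc (x ++ [u]), hc u b]
    · refine ⟨b :: p, ⟨⟨by simp, rfl, by simpa using hpt, List.isChain_cons_cons.2 ⟨hub, hpA⟩⟩,
        List.nodup_cons.2 ⟨hu, hpn⟩⟩, ?_⟩
      simpa [linCost] using hle


/-- admissibility of the backward cost-to-go estimate. With nonnegative
costs, for a walk `w = (w₁,…,wₙ)` from `s` to `t` and an index `m` with `2 ≤ m ≤ n`
(so `v = w_m`), paths from `w_m` to `t` exist and
`C((w₁,…,w_m)) + B(w_m) ≤ C(w)`, where `B(w_m)` is the minimum linear cost of a path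
from `w_m` to `t`. -/
theorem astar_admissible {V : Type*} [Fintype V] (A : V → V → Prop)
    (c : V → V → ℝ) (q : V → V → V → ℝ)
    (hc : ∀ u v, 0 ≤ c u v) (hq : ∀ u v x, 0 ≤ q u v x)
    (s t : V) (w : List V) (hw : IsWalk A s t w)
    (m : ℕ) (hm1 : 2 ≤ m) (hm2 : m ≤ w.length)
    (v : V) (hv : w[m - 1]? = some v) :
    (∃ p, IsPath A v t p) ∧
    ∀ B : ℝ, IsLeast {x : ℝ | ∃ p, IsPath A v t p ∧ linCost c p = x} B →
      cost c q (w.take m) + B ≤ cost c q w := by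
  obtain ⟨-, -, hwt, hwA⟩ := hw
  obtain ⟨k, rfl⟩ : ∃ k, m = k + 1 := ⟨m - 1, by omega⟩
  rw [Nat.add_sub_cancel] at hv
  obtain ⟨hk, hkv⟩ := List.getElem?_eq_some_iff.1 hv
  have hdrop : w.drop k = v :: w.drop (k + 1) := by
    rw [List.drop_eq_getElem_cons hk, hkv]
  have hsplit : w = w.take k ++ v :: w.drop (k + 1) := by
    rw [← hdrop, List.take_append_drop]
  have htake : w.take (k + 1) = w.take k ++ [v] := by
    rw [List.take_add_one, hv, Option.toList_some]
  rw [hsplit] at hwt hwA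
  obtain ⟨l, hpath, hle⟩ := exists_isPath_linCost_le hc (w.drop (k + 1)) v
    hwA.right_of_append (by simpa using hwt)
  refine ⟨⟨_, hpath⟩, fun B hB => ?_⟩
  have hBle : B ≤ linCost c (v :: l) := hB.2 ⟨_, hpath, rfl⟩
  have hlin : linCost c w = linCost c (w.take (k + 1)) + linCost c (v :: w.drop (k + 1)) := by
    rw [htake, ← linCost_append_cons, ← hsplit]
  have hquad := quadCost_le_append hq (w.take (k + 1)) (w.drop (k + 1))
  rw [List.take_append_drop] at hquad
  unfold cost
  linarith
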